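/- Let n ≥ 4 be an even integer and let F : F_2^n → F_2^n be a plateaued APN function. Then the number of nonzero v ∈ F_2^n for which the component function x ↦ v·F(x) is bent is not equal to 2^n − 2^{n/2}; that is, F does not have the maximum number of bent components. -/

import Mathlib

open Finset

/-- The dot product on `F_2^n`. -/
def dotp {n : ℕ} (v x : Fin n → ZMod 2) : ZMod 2 := ∑ i, v i * x i

/-- A Boolean function on `F_2^n` is bent if all its Walsh values square to `2^n`. -/
def IsBent {n : ℕ} (f : (Fin n → ZMod 2) → ZMod 2) : Prop :=
  ∀ u : Fin n → ZMod 2,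
    (∑ x : Fin n → ZMod 2, (-1 : ℤ) ^ (f x + dotp u x).val) ^ 2 = 2 ^ n

/-- The extended Walsh transform of `F : F_2^n → F_2^n` at `(u, v)`. -/
def walshF {n : ℕ} (F : (Fin n → ZMod 2) → (Fin n → ZMod 2))
    (u v : Fin n → ZMod 2) : ℤ :=
  ∑ x : Fin n → ZMod 2, (-1 : ℤ) ^ (dotp v (F x) + dotp u x).val

/-- `F` is APN: every derivative equation has at most 2 solutions. -/
def IsAPN {n : ℕ} (F : (Fin n → ZMod 2) → (Fin n → ZMod 2)) : Prop :=
  ∀ a : Fin n → ZMod 2, a ≠ 0 → ∀ b : Fin n → ZMod 2,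
    Nat.card {x : Fin n → ZMod 2 // F (x + a) + F x = b} ≤ 2

/-- `F` is plateaued: every nonzero component is plateaued of some amplitude. -/
def IsPlateaued {n : ℕ} (F : (Fin n → ZMod 2) → (Fin n → ZMod 2)) : Prop :=
  ∀ v : Fin n → ZMod 2, v ≠ 0 → ∃ t : ℕ, t ≤ n ∧
    ∀ u : Fin n → ZMod 2, (walshF F u v) ^ 2 = 0 ∨ (walshF F u v) ^ 2 = 2 ^ (n + t)

/-- The nontrivial additive character of `F_2`, with integer values. -/
def signChar (a : ZMod 2) : ℤ := (-1) ^ a.val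

theorem signChar_add (a b : ZMod 2) : signChar (a + b) = signChar a * signChar b := by
  revert a b; decide

theorem signChar_mul_self (a : ZMod 2) : signChar a * signChar a = 1 := by
  revert a; decide

theorem add_self_vec {n : ℕ} (x : Fin n → ZMod 2) : x + x = 0 := by
  funext i; exact CharTwo.add_self_eq_zero _

theorem add_eq_zero_iff_eq_vec {n : ℕ} (x y : Fin n → ZMod 2) : x + y = 0 ↔ x = y := by
  constructor
  · intro h
    calc x = x + (y + y) := by rw [add_self_vec, add_zero]
      _ = (x + y) + y := by abel
      _ = y := by rw [h, zero_add]
  · rintro rfl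
    exact add_self_vec x

theorem dotp_add_left {n : ℕ} (u v x : Fin n → ZMod 2) :
    dotp (u + v) x = dotp u x + dotp v x := by
  simp [dotp, add_mul, Finset.sum_add_distrib]

theorem dotp_add_right {n : ℕ} (u x y : Fin n → ZMod 2) :
    dotp u (x + y) = dotp u x + dotp u y := by
  simp [dotp, mul_add, Finset.sum_add_distrib]

theorem sum_signChar_dotp {n : ℕ} (x : Fin n → ZMod 2) :
    ∑ u : Fin n → ZMod 2, signChar (dotp u x) = if x = 0 then 2 ^ n else 0 := by
  split_ifs with h
  · subst h
    simp [dotp, signChar]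
  · obtain ⟨i, hi⟩ := Function.ne_iff.mp h
    have hxi : x i = 1 := by
      have : ∀ a : ZMod 2, a ≠ 0 → a = 1 := by decide
      exact this _ hi
    have hdot : dotp (Pi.single i 1) x = 1 := by
      simp [dotp, Pi.single_apply, hxi]
    have hsum : ∑ u : Fin n → ZMod 2, signChar (dotp u x) =
        ∑ u : Fin n → ZMod 2, -signChar (dotp u x) := by
      rw [← Equiv.sum_comp (Equiv.addRight (Pi.single i (1 : ZMod 2)))]
      refine Finset.sum_congr rfl fun u _ => ?_
      rw [Equiv.coe_addRight, dotp_add_left, signChar_add, hdot]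
      simp [signChar, ZMod.val_one]
    rw [Finset.sum_neg_distrib] at hsum
    linarith

/-- Parseval's identity for weighted exponential sums over a family of points of `F_2^n`. -/
theorem sum_sq_signChar {n : ℕ} {ι : Type*} [Fintype ι] (w : ι → ℤ)
    (φ : ι → Fin n → ZMod 2) :
    ∑ u : Fin n → ZMod 2, (∑ i, w i * signChar (dotp u (φ i))) ^ 2 =
      2 ^ n * ∑ i, ∑ j, if φ i = φ j then w i * w j else 0 := by
  have expand : ∀ u : Fin n → ZMod 2, (∑ i, w i * signChar (dotp u (φ i))) ^ 2 =
      ∑ i, ∑ j, w i * w j * signChar (dotp u (φ i + φ j)) := by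
    intro u
    rw [sq, Finset.sum_mul_sum]
    refine Finset.sum_congr rfl fun i _ => Finset.sum_congr rfl fun j _ => ?_
    rw [dotp_add_right, signChar_add]
    ring
  simp_rw [expand]
  rw [Finset.sum_comm, Finset.mul_sum]
  refine Finset.sum_congr rfl fun i _ => ?_
  rw [Finset.sum_comm, Finset.mul_sum]
  refine Finset.sum_congr rfl fun j _ => ?_
  rw [← Finset.mul_sum, sum_signChar_dotp]
  simp only [add_eq_zero_iff_eq_vec]
  split_ifs <;> ring

theorem sum_sq_fourier {n : ℕ} (g : (Fin n → ZMod 2) → ℤ) :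
    ∑ u : Fin n → ZMod 2, (∑ x, g x * signChar (dotp u x)) ^ 2 = 2 ^ n * ∑ x, g x ^ 2 := by
  have h := sum_sq_signChar g id
  simpa [← sq] using h

theorem fourier_sq {n : ℕ} (g : (Fin n → ZMod 2) → ℤ) (u : Fin n → ZMod 2) :
    (∑ x, g x * signChar (dotp u x)) ^ 2 =
      ∑ a, (∑ x, g (x + a) * g x) * signChar (dotp u a) := by
  rw [sq, Finset.sum_mul_sum]
  simp_rw [Finset.sum_mul]
  conv_rhs => rw [Finset.sum_comm]
  refine Finset.sum_congr rfl fun x _ => ?_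
  rw [← Equiv.sum_comp (Equiv.addLeft x)]
  refine Finset.sum_congr rfl fun a _ => ?_
  rw [Equiv.coe_addLeft, dotp_add_right, signChar_add]
  linear_combination (g (x + a) * g x * signChar (dotp u a)) * signChar_mul_self (dotp u x)

theorem sum_fourth_fourier {n : ℕ} (g : (Fin n → ZMod 2) → ℤ) :
    ∑ u : Fin n → ZMod 2, (∑ x, g x * signChar (dotp u x)) ^ 4 =
      2 ^ n * ∑ a, (∑ x, g (x + a) * g x) ^ 2 := by
  rw [← sum_sq_fourier]
  refine Finset.sum_congr rfl fun u _ => ?_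
  rw [← fourier_sq]
  ring

section Walsh

variable {n : ℕ} (F : (Fin n → ZMod 2) → (Fin n → ZMod 2))

theorem walshF_eq_fourier (u v : Fin n → ZMod 2) :
    walshF F u v = ∑ x, signChar (dotp v (F x)) * signChar (dotp u x) := by
  simp_rw [← signChar_add]
  rfl

theorem isBent_component_iff (v : Fin n → ZMod 2) :
    (IsBent fun x => dotp v (F x)) ↔ ∀ u, walshF F u v ^ 2 = 2 ^ n := Iff.rfl

theorem sum_walshF_sq (v : Fin n → ZMod 2) :
    ∑ u, walshF F u v ^ 2 = 2 ^ (2 * n) := by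
  simp_rw [walshF_eq_fourier]
  rw [sum_sq_fourier]
  simp_rw [sq (signChar _), signChar_mul_self]
  simp
  ring

/-- The fourth moment of the extended Walsh transform counts the coincidences of derivatives. -/
theorem sum_sum_walshF_fourth :
    ∑ v, ∑ u, walshF F u v ^ 4 = 2 ^ (2 * n) * ∑ a : Fin n → ZMod 2, ∑ x,
      ((Finset.univ.filter fun y => F (y + a) + F y = F (x + a) + F x).card : ℤ) := by
  simp_rw [walshF_eq_fourier, sum_fourth_fourier, ← signChar_add, ← dotp_add_right]
  rw [← Finset.mul_sum, Finset.sum_comm, two_mul, pow_add, mul_assoc]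
  congr 1
  rw [Finset.mul_sum]
  refine Finset.sum_congr rfl fun a _ => ?_
  have h := sum_sq_signChar (fun _ : Fin n → ZMod 2 => 1) fun x => F (x + a) + F x
  simp only [one_mul] at h
  rw [h]
  congr 1
  refine Finset.sum_congr rfl fun x _ => ?_
  rw [Finset.sum_boole]
  simp_rw [eq_comm]

variable {F}

theorem IsAPN.card_derivative_fiber (hF : IsAPN F) {a : Fin n → ZMod 2} (ha : a ≠ 0)
    (x : Fin n → ZMod 2) :
    (Finset.univ.filter fun y => F (y + a) + F y = F (x + a) + F x).card = 2 := by
  apply le_antisymm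
  · have h := hF a ha (F (x + a) + F x)
    rwa [Nat.card_eq_fintype_card, Fintype.card_subtype] at h
  · have hne : x ≠ x + a := by simpa using ha
    refine (Finset.card_pair hne).ge.trans ?_
    apply Finset.card_le_card
    intro y hy
    rw [Finset.mem_insert, Finset.mem_singleton] at hy
    rw [Finset.mem_filter]
    refine ⟨Finset.mem_univ _, ?_⟩
    rcases hy with rfl | rfl
    · rfl
    · rw [add_assoc, add_self_vec, add_zero, add_comm]

theorem IsAPN.sum_sum_walshF_fourth (hF : IsAPN F) :
    ∑ v, ∑ u, walshF F u v ^ 4 = 2 ^ (3 * n) * (3 * 2 ^ n - 2) := by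
  rw [_root_.sum_sum_walshF_fourth, ← Finset.add_sum_erase _ _ (Finset.mem_univ 0)]
  have hsum : ∀ a ∈ (Finset.univ : Finset (Fin n → ZMod 2)).erase 0, ∑ x,
      ((Finset.univ.filter fun y => F (y + a) + F y = F (x + a) + F x).card : ℤ) =
        2 ^ n * 2 := by
    intro a ha
    simp_rw [hF.card_derivative_fiber (Finset.ne_of_mem_erase ha)]
    simp
  rw [Finset.sum_congr rfl hsum]
  have hzero : ∀ x : Fin n → ZMod 2, F x + F x = 0 := fun x => add_self_vec _
  simp [hzero, Finset.card_erase_of_mem]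
  ring

theorem sum_walshF_zero_fourth : ∑ u, walshF F u 0 ^ 4 = 2 ^ (4 * n) := by
  simp_rw [walshF_eq_fourier, sum_fourth_fourier]
  simp [dotp, signChar]
  ring

theorem sum_walshF_fourth_of_isBent {v : Fin n → ZMod 2}
    (hv : IsBent fun x => dotp v (F x)) : ∑ u, walshF F u v ^ 4 = 2 ^ (3 * n) := by
  rw [isBent_component_iff] at hv
  have h : ∀ u, walshF F u v ^ 4 = 2 ^ (2 * n) := fun u => by
    rw [show walshF F u v ^ 4 = (walshF F u v ^ 2) ^ 2 by ring, hv u]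
    ring
  simp [h]
  ring

/-- In even dimension the amplitude of a plateaued component that is not bent exceeds that of a
bent function by a factor of at least two, so its fourth moment gains a factor of four. -/
theorem IsPlateaued.exists_sum_walshF_fourth (hF : IsPlateaued F) (hn : Even n)
    {v : Fin n → ZMod 2} (hv : v ≠ 0) (hnb : ¬ IsBent fun x => dotp v (F x)) :
    ∃ m : ℤ, ∑ u, walshF F u v ^ 4 = 2 ^ (3 * n) * (4 * m) := by
  obtain ⟨t, -, ht⟩ := hF v hv
  have hne : ∃ u, walshF F u v ≠ 0 := by
    by_contra! h
    have hsum := sum_walshF_sq F v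
    simp only [h, ne_eq, OfNat.ofNat_ne_zero, not_false_eq_true, zero_pow,
      Finset.sum_const_zero] at hsum
    exact (pow_ne_zero (2 * n) (two_ne_zero' ℤ)) hsum.symm
  have heven : Even t := by
    obtain ⟨u, hu⟩ := hne
    have hsq : walshF F u v ^ 2 = 2 ^ (n + t) := (ht u).resolve_left (pow_ne_zero 2 hu)
    have habs : (walshF F u v).natAbs ^ 2 = 2 ^ (n + t) := by
      zify
      rw [sq_abs, hsq]
    obtain ⟨k, -, hk⟩ := (Nat.dvd_prime_pow Nat.prime_two).mp
      (habs ▸ dvd_pow_self (walshF F u v).natAbs two_ne_zero)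
    rw [hk, ← pow_mul] at habs
    have hexp : k * 2 = n + t := Nat.pow_right_injective le_rfl habs
    exact (Nat.even_add.mp (hexp ▸ even_two.mul_left k)).mp hn
  have hpos : t ≠ 0 := by
    rintro rfl
    apply hnb
    rw [isBent_component_iff]
    have hle : ∀ u ∈ (Finset.univ : Finset (Fin n → ZMod 2)),
        walshF F u v ^ 2 ≤ 2 ^ n := fun u _ => by
      rcases ht u with h | h <;> rw [h]
      · positivity
      · simp
    have hsum : ∑ u, walshF F u v ^ 2 = ∑ _u : Fin n → ZMod 2, (2 : ℤ) ^ n := by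
      rw [sum_walshF_sq]
      simp
      ring
    exact fun u => (Finset.sum_eq_sum_iff_of_le hle).mp hsum u (Finset.mem_univ u)
  obtain ⟨s, rfl⟩ : ∃ s, t = s + 2 := by
    obtain ⟨r, rfl⟩ := heven
    exact ⟨2 * (r - 1), by omega⟩
  refine ⟨2 ^ s, ?_⟩
  have h : ∀ u, walshF F u v ^ 4 = 2 ^ (n + (s + 2)) * walshF F u v ^ 2 := fun u => by
    rw [show walshF F u v ^ 4 = walshF F u v ^ 2 * walshF F u v ^ 2 by ring]
    rcases ht u with h | h <;> rw [h]
    ring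
  simp_rw [h]
  rw [← Finset.mul_sum, sum_walshF_sq]
  ring

end Walsh

theorem stmt_1 (n : ℕ) (hn4 : 4 ≤ n) (hneven : Even n)
    (F : (Fin n → ZMod 2) → (Fin n → ZMod 2))
    (hAPN : IsAPN F) (hPlat : IsPlateaued F) :
    Nat.card {v : Fin n → ZMod 2 // v ≠ 0 ∧ IsBent fun x => dotp v (F x)} ≠
      2 ^ n - 2 ^ (n / 2) := by
  classical
  intro hcard
  have hmoment : ∀ v ∈ (Finset.univ : Finset (Fin n → ZMod 2)).erase 0, ∃ m : ℤ,
      ∑ u, walshF F u v ^ 4 =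
        2 ^ (3 * n) * ((if IsBent fun x => dotp v (F x) then 1 else 0) + 4 * m) := by
    intro v hv
    by_cases hb : IsBent fun x => dotp v (F x)
    · exact ⟨0, by simp [hb, sum_walshF_fourth_of_isBent hb]⟩
    · simpa [hb] using hPlat.exists_sum_walshF_fourth hneven (Finset.ne_of_mem_erase hv) hb
  choose! m hm using hmoment
  have htotal := hAPN.sum_sum_walshF_fourth
  rw [← Finset.add_sum_erase _ _ (Finset.mem_univ 0), Finset.sum_congr rfl hm,
    sum_walshF_zero_fourth, ← Finset.mul_sum, Finset.sum_add_distrib, ← Finset.mul_sum,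
    Finset.sum_boole] at htotal
  have hset : ((Finset.univ.erase 0).filter fun v : Fin n → ZMod 2 =>
      IsBent fun x => dotp v (F x)).card = 2 ^ n - 2 ^ (n / 2) := by
    rw [← hcard, Nat.card_eq_fintype_card, Fintype.card_subtype]
    congr 1
    ext v
    simp
  rw [hset, show 4 * n = 3 * n + n by ring, pow_add, ← mul_add] at htotal
  have hcancel := mul_left_cancel₀ (by positivity) htotal
  have hle : 2 ^ (n / 2) ≤ 2 ^ n := Nat.pow_le_pow_right two_pos (Nat.div_le_self n 2)
  rw [Nat.cast_sub hle] at hcancel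
  push_cast at hcancel
  have hdvd : ∀ k, 2 ≤ k → (4 : ℤ) ∣ 2 ^ k := fun k hk => pow_dvd_pow (2 : ℤ) hk
  have hdvd_n := hdvd n (by omega)
  have hdvd_half := hdvd (n / 2) (by omega)
  omega
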